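/- arXiv:1301.6363 — 9 statements merged into one kernel-verified Lean document; each statement's English description precedes it below -/
import Mathlib

section
/- The separating hyperplane obtained from a reference point on the axis below the lowest piercing point is oriented downwards. Precisely: let r = ρ·e_{k+1} with ρ < z_LP. Then the last coordinate of a(r) is strictly negative: a(r)_{k+1} < 0. -/
open RealInnerProductSpace

/-- For a reference point `r = ρ·e_{k+1}` on the last coordinate axis with `ρ` strictly below
the lowest piercing point `z_LP = (v_LP)_{k+1}` of the axis through the polytope `Q`, the
separating hyperplane normal `a(r) = r - NP(r)` is oriented downwards:
`a(r)_{k+1} < 0`. -/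
theorem reference_point_hyperplane_downwards {k : ℕ}
    (s : Finset (EuclideanSpace ℝ (Fin (k + 1)))) (hs : s.Nonempty)
    (Q : Set (EuclideanSpace ℝ (Fin (k + 1))))
    (hQ : Q = convexHull ℝ (s : Set (EuclideanSpace ℝ (Fin (k + 1)))))
    (NP : EuclideanSpace ℝ (Fin (k + 1)) → EuclideanSpace ℝ (Fin (k + 1)))
    (hNP : ∀ r, NP r ∈ Q ∧ ∀ v ∈ Q, ‖NP r - r‖ ≤ ‖v - r‖)
    (vLP : EuclideanSpace ℝ (Fin (k + 1)))
    (hvLPQ : vLP ∈ Q) (hvLPax : ∀ i : Fin k, vLP i.castSucc = 0)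
    (hvLPmin : ∀ v ∈ Q, (∀ i : Fin k, v i.castSucc = 0) →
      vLP (Fin.last k) ≤ v (Fin.last k))
    (ρ : ℝ) (hρ : ρ < vLP (Fin.last k))
    (r : EuclideanSpace ℝ (Fin (k + 1)))
    (hrax : ∀ i : Fin k, r i.castSucc = 0) (hrlast : r (Fin.last k) = ρ) :
    (r - NP r) (Fin.last k) < 0 := by
  have hconv : Convex ℝ Q := hQ ▸ convex_convexHull ℝ _
  obtain ⟨hpQ, hpmin⟩ := hNP r
  have hinf : ‖r - NP r‖ = ⨅ w : Q, ‖r - w‖ := by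
    have : Nonempty Q := ⟨⟨_, hpQ⟩⟩
    apply le_antisymm
    · apply le_ciInf
      intro w
      rw [norm_sub_rev r, norm_sub_rev r]
      exact hpmin w w.2
    · exact ciInf_le (f := fun w : Q => ‖r - (w : EuclideanSpace ℝ (Fin (k + 1)))‖)
        ⟨0, by rintro _ ⟨w, rfl⟩; exact norm_nonneg _⟩ ⟨NP r, hpQ⟩
  have h1 := (norm_eq_iInf_iff_real_inner_le_zero hconv hpQ).1 hinf vLP hvLPQ
  have hne : r - NP r ≠ 0 := by
    intro h
    have hr : r = NP r := sub_eq_zero.1 h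
    have := hvLPmin r (hr ▸ hpQ) hrax
    linarith
  have hpos : 0 < ⟪r - NP r, r - NP r⟫ := real_inner_self_pos.2 hne
  have h2 : ⟪r - NP r, vLP - r⟫
      = (vLP (Fin.last k) - ρ) * (r - NP r) (Fin.last k) := by
    rw [PiLp.inner_apply, Fin.sum_univ_castSucc]
    simp [hvLPax, hrax, hrlast]
  have h3 : vLP - NP r = (vLP - r) + (r - NP r) := by abel
  rw [h3, inner_add_right, h2] at h1
  by_contra hc
  have := mul_nonneg (sub_pos.2 hρ).le (not_lt.1 hc)
  linarith
end

section
/- If updating the reference point to the intersection of the separating hyperplane with the axis does not change the induced nearest face, then that intersection point is the lowest piercing point. Precisely: let r = ρ·e_{k+1} with ρ < z_LP (so a(r)_{k+1} < 0), and let s = (b(r)/a(r)_{k+1})·e_{k+1} be the intersection of the hyperplane {v : ⟪a(r), v⟫ = b(r)} with A_c. If NF(r) = NF(s), then s = v_LP. -/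
open RealInnerProductSpace

/-- Variational inequality for a nearest point. -/
lemma nearest_var {E : Type*} [NormedAddCommGroup E] [InnerProductSpace ℝ E] {Q : Set E}
    (hc : Convex ℝ Q) {p r : E} (hp : p ∈ Q) (h : ∀ v ∈ Q, ‖p - r‖ ≤ ‖v - r‖) :
    ∀ v ∈ Q, ⟪r - p, v - p⟫ ≤ 0 := by
  refine (norm_eq_iInf_iff_real_inner_le_zero hc hp).1 ?_
  haveI : Nonempty Q := ⟨⟨p, hp⟩⟩
  apply le_antisymm
  · refine le_ciInf fun w => ?_
    rw [norm_sub_rev r p, norm_sub_rev r]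
    exact h w w.2
  · exact ciInf_le (f := fun w : Q => ‖r - w‖)
      ⟨0, by rintro _ ⟨w, rfl⟩; exact norm_nonneg _⟩ ⟨p, hp⟩

/-- Inner product with a vector on the last axis. -/
lemma inner_axis {k : ℕ} (a x : EuclideanSpace ℝ (Fin (k + 1)))
    (hx : ∀ i : Fin k, x i.castSucc = 0) :
    ⟪a, x⟫ = a (Fin.last k) * x (Fin.last k) := by
  rw [PiLp.inner_apply, Fin.sum_univ_castSucc]
  simp [hx, mul_comm]

/-- If updating the reference point `r = ρ·e_{k+1}` (with `ρ < z_LP`) to the intersection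
point `s` of the separating hyperplane `{v : ⟪a(r), v⟫ = b(r)}` with the axis `A_c` does
not change the induced nearest face, i.e. `NF(r) = NF(s)`, then `s` is the lowest piercing
point `v_LP`. -/
theorem same_nearest_face_implies_optimal {k : ℕ}
    (s : Finset (EuclideanSpace ℝ (Fin (k + 1)))) (hs : s.Nonempty)
    (Q : Set (EuclideanSpace ℝ (Fin (k + 1))))
    (hQ : Q = convexHull ℝ (s : Set (EuclideanSpace ℝ (Fin (k + 1)))))
    (NP : EuclideanSpace ℝ (Fin (k + 1)) → EuclideanSpace ℝ (Fin (k + 1)))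
    (hNP : ∀ r, NP r ∈ Q ∧ ∀ v ∈ Q, ‖NP r - r‖ ≤ ‖v - r‖)
    (vLP : EuclideanSpace ℝ (Fin (k + 1)))
    (hvLPQ : vLP ∈ Q) (hvLPax : ∀ i : Fin k, vLP i.castSucc = 0)
    (hvLPmin : ∀ v ∈ Q, (∀ i : Fin k, v i.castSucc = 0) →
      vLP (Fin.last k) ≤ v (Fin.last k))
    (ρ : ℝ) (hρ : ρ < vLP (Fin.last k))
    (r : EuclideanSpace ℝ (Fin (k + 1)))
    (hrax : ∀ i : Fin k, r i.castSucc = 0) (hrlast : r (Fin.last k) = ρ)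
    (spt : EuclideanSpace ℝ (Fin (k + 1)))
    (hsptax : ∀ i : Fin k, spt i.castSucc = 0)
    (hsptlast : spt (Fin.last k) = ⟪r - NP r, NP r⟫ / (r - NP r) (Fin.last k))
    (hNF : {v ∈ Q | ⟪r - NP r, v⟫ = ⟪r - NP r, NP r⟫}
         = {v ∈ Q | ⟪spt - NP spt, v⟫ = ⟪spt - NP spt, NP spt⟫}) :
    spt = vLP := by
  have hc : Convex ℝ Q := hQ ▸ convex_convexHull ℝ _
  have ext_ax : ∀ x y : EuclideanSpace ℝ (Fin (k + 1)), (∀ i : Fin k, x i.castSucc = 0) →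
      (∀ i : Fin k, y i.castSucc = 0) → x (Fin.last k) = y (Fin.last k) → x = y := by
    intro x y hx hy hl
    ext i
    refine Fin.lastCases hl (fun j => ?_) i
    rw [hx, hy]
  obtain ⟨hpQ, hpm⟩ := hNP r
  obtain ⟨hqQ, hqm⟩ := hNP spt
  have hpv := nearest_var hc hpQ hpm
  have hqv := nearest_var hc hqQ hqm
  have hpm' : NP r ∈ {v ∈ Q | ⟪spt - NP spt, v⟫ = ⟪spt - NP spt, NP spt⟫} := by
    rw [← hNF]; exact ⟨hpQ, rfl⟩
  have hqm' : NP spt ∈ {v ∈ Q | ⟪r - NP r, v⟫ = ⟪r - NP r, NP r⟫} := by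
    rw [hNF]; exact ⟨hqQ, rfl⟩
  have e1 := hpm'.2
  have e2 := hqm'.2
  generalize NP r = p at *
  generalize NP spt = q at *
  obtain ⟨a, ha⟩ : ∃ a, a = r - p := ⟨_, rfl⟩
  obtain ⟨c, hcc⟩ : ∃ c, c = spt - q := ⟨_, rfl⟩
  rw [← ha] at hpv e2 hsptlast
  rw [← hcc] at hqv e1
  have hp : p = r - a := by rw [ha]; abel
  have hq : q = spt - c := by rw [hcc]; abel
  have ane : a ≠ 0 := by
    intro h0
    rw [h0, sub_zero] at hp
    have := hvLPmin r (hp ▸ hpQ) hrax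
    linarith
  have apos : 0 < ⟪a, a⟫ := real_inner_self_pos.2 ane
  have v1 := hpv vLP hvLPQ
  have v2 := hqv vLP hvLPQ
  have ar := inner_axis a r hrax
  have as' := inner_axis a spt hsptax
  have av := inner_axis a vLP hvLPax
  have cr := inner_axis c r hrax
  have cs := inner_axis c spt hsptax
  have cv := inner_axis c vLP hvLPax
  have ac := real_inner_comm a c
  rw [hp] at e1 e2 hsptlast v1
  rw [hq] at e1 e2 v2
  simp only [inner_sub_right] at e1 e2 hsptlast v1 v2
  have alneg : a (Fin.last k) < 0 := by
    by_contra h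
    have := mul_nonneg (not_lt.1 h) (sub_pos.2 hρ).le
    rw [hrlast] at ar
    nlinarith
  have hb : a (Fin.last k) * spt (Fin.last k) = ⟪a, r⟫ - ⟪a, a⟫ := by
    rw [hsptlast]; field_simp [alneg.ne]
  have hsz : spt (Fin.last k) ≤ vLP (Fin.last k) := by
    by_contra h
    have := mul_pos_of_neg_of_neg alneg (sub_neg.2 (not_le.1 h))
    nlinarith
  have hrs : r (Fin.last k) < spt (Fin.last k) := by
    by_contra h
    have := mul_nonneg_of_nonpos_of_nonpos alneg.le (sub_nonpos.2 (not_lt.1 h))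
    nlinarith
  have c0 : c = 0 := by
    by_contra cne
    have cpos : 0 < ⟪c, c⟫ := real_inner_self_pos.2 cne
    have h1 : ⟪c, c⟫ = c (Fin.last k) * (spt (Fin.last k) - r (Fin.last k)) := by
      linarith
    have h2 : 0 < c (Fin.last k) := by
      rw [h1] at cpos
      exact pos_of_mul_pos_left cpos (sub_pos.2 hrs).le
    have := mul_nonneg h2.le (sub_nonneg.2 hsz)
    linarith
  rw [c0, sub_zero] at hq
  exact ext_ax _ _ hsptax hvLPax (le_antisymm hsz (hvLPmin spt (hq ▸ hqQ) hsptax))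
end

section
/- If two inequalities of nearest-point type induce the same face of a polytope, then every convex combination of them is valid and induces that same face. Precisely: let P ⊆ ℝ^n be a polytope, x¹, x² ∈ P, r¹, r² ∉ P, and suppose that for i = 1, 2 the inequality ⟪rⁱ − xⁱ, x⟫ ≤ ⟪rⁱ − xⁱ, xⁱ⟫ holds for all x ∈ P and that the two faces Fⁱ = {x ∈ P : ⟪rⁱ − xⁱ, x⟫ = ⟪rⁱ − xⁱ, xⁱ⟫} are equal to a common set F. Then for every λ ∈ [0,1], setting r̄ = λ r¹ + (1−λ) r² and x̄ = λ x¹ + (1−λ) x², the inequality ⟪r̄ − x̄, x⟫ ≤ ⟪r̄ − x̄, x̄⟫ holds for all x ∈ P, and {x ∈ P : ⟪r̄ − x̄, x⟫ = ⟪r̄ − x̄, x̄⟫} = F. -/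
open RealInnerProductSpace

/-- If two inequalities of nearest-point type induce the same face `F` of a polytope `P`,
then every convex combination of them is valid for `P` and induces the same face `F`. -/
theorem convex_combination_face_defining_inequalities {n : ℕ}
    (s : Finset (EuclideanSpace ℝ (Fin n))) (hs : s.Nonempty)
    (P : Set (EuclideanSpace ℝ (Fin n)))
    (hP : P = convexHull ℝ (s : Set (EuclideanSpace ℝ (Fin n))))
    (x₁ x₂ r₁ r₂ : EuclideanSpace ℝ (Fin n))
    (hx₁ : x₁ ∈ P) (hx₂ : x₂ ∈ P) (hr₁ : r₁ ∉ P) (hr₂ : r₂ ∉ P)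
    (hvalid₁ : ∀ x ∈ P, ⟪r₁ - x₁, x⟫ ≤ ⟪r₁ - x₁, x₁⟫)
    (hvalid₂ : ∀ x ∈ P, ⟪r₂ - x₂, x⟫ ≤ ⟪r₂ - x₂, x₂⟫)
    (F : Set (EuclideanSpace ℝ (Fin n)))
    (hF₁ : {x ∈ P | ⟪r₁ - x₁, x⟫ = ⟪r₁ - x₁, x₁⟫} = F)
    (hF₂ : {x ∈ P | ⟪r₂ - x₂, x⟫ = ⟪r₂ - x₂, x₂⟫} = F)
    (lam : ℝ) (hlam : lam ∈ Set.Icc (0 : ℝ) 1) :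
    (∀ x ∈ P,
      ⟪(lam • r₁ + (1 - lam) • r₂) - (lam • x₁ + (1 - lam) • x₂), x⟫
        ≤ ⟪(lam • r₁ + (1 - lam) • r₂) - (lam • x₁ + (1 - lam) • x₂),
            lam • x₁ + (1 - lam) • x₂⟫) ∧
    {x ∈ P |
      ⟪(lam • r₁ + (1 - lam) • r₂) - (lam • x₁ + (1 - lam) • x₂), x⟫
        = ⟪(lam • r₁ + (1 - lam) • r₂) - (lam • x₁ + (1 - lam) • x₂),
            lam • x₁ + (1 - lam) • x₂⟫} = F := by
  obtain ⟨h0, h1⟩ := hlam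
  have m1 : x₁ ∈ F := by rw [← hF₁]; exact ⟨hx₁, rfl⟩
  have m2 : x₂ ∈ F := by rw [← hF₂]; exact ⟨hx₂, rfl⟩
  have e1 : ⟪r₁ - x₁, x₂⟫ = ⟪r₁ - x₁, x₁⟫ := by rw [← hF₁] at m2; exact m2.2
  have e2 : ⟪r₂ - x₂, x₁⟫ = ⟪r₂ - x₂, x₂⟫ := by rw [← hF₂] at m1; exact m1.2
  have hd : (lam • r₁ + (1 - lam) • r₂) - (lam • x₁ + (1 - lam) • x₂)
      = lam • (r₁ - x₁) + (1 - lam) • (r₂ - x₂) := by module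
  have hl : ∀ x, ⟪lam • (r₁ - x₁) + (1 - lam) • (r₂ - x₂), x⟫
      = lam * ⟪r₁ - x₁, x⟫ + (1 - lam) * ⟪r₂ - x₂, x⟫ := by
    intro x
    rw [inner_add_left, real_inner_smul_left, real_inner_smul_left]
  have hr : ⟪lam • (r₁ - x₁) + (1 - lam) • (r₂ - x₂), lam • x₁ + (1 - lam) • x₂⟫
      = lam * ⟪r₁ - x₁, x₁⟫ + (1 - lam) * ⟪r₂ - x₂, x₂⟫ := by
    rw [hl]
    simp only [inner_add_right, real_inner_smul_right]
    rw [e1, e2]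
    ring
  rw [hd, hr]
  simp only [hl]
  have k1 : ∀ x ∈ P, lam * ⟪r₁ - x₁, x⟫ ≤ lam * ⟪r₁ - x₁, x₁⟫ := fun x hx =>
    mul_le_mul_of_nonneg_left (hvalid₁ x hx) h0
  have k2 : ∀ x ∈ P, (1 - lam) * ⟪r₂ - x₂, x⟫ ≤ (1 - lam) * ⟪r₂ - x₂, x₂⟫ := fun x hx =>
    mul_le_mul_of_nonneg_left (hvalid₂ x hx) (sub_nonneg.2 h1)
  refine ⟨fun x hx => add_le_add (k1 x hx) (k2 x hx), ?_⟩
  ext x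
  constructor
  · rintro ⟨hx, he⟩
    have a1 := k1 x hx
    have a2 := k2 x hx
    rcases h0.eq_or_lt with h | h
    · rw [← hF₂]
      refine ⟨hx, ?_⟩
      subst h
      simpa using he
    · rw [← hF₁]
      refine ⟨hx, mul_left_cancel₀ h.ne' ?_⟩
      linarith
  · intro hx
    have q1 := hx
    have q2 := hx
    rw [← hF₁] at q1
    rw [← hF₂] at q2
    refine ⟨q1.1, ?_⟩
    rw [q1.2, q2.2]
end

section
/- Reference points on the axis below the lowest piercing point that yield the same nearest face form intervals. Precisely: let ρ₁ < ρ₂ < z_LP and set r¹ = ρ₁·e_{k+1}, r² = ρ₂·e_{k+1}. If NF(r¹) = NF(r²), then for every ρ ∈ [ρ₁, ρ₂] one has NF(ρ·e_{k+1}) = NF(r¹). -/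
open RealInnerProductSpace

/-- Reference points on the axis `A_c` below the lowest piercing point `v_LP` that yield the
same nearest face form intervals: if `ρ₁ < ρ₂ < z_LP` and `NF(ρ₁·e_{k+1}) = NF(ρ₂·e_{k+1})`,
then `NF(ρ·e_{k+1}) = NF(ρ₁·e_{k+1})` for every `ρ ∈ [ρ₁, ρ₂]`. -/
theorem nearest_face_intervals {k : ℕ}
    (s : Finset (EuclideanSpace ℝ (Fin (k + 1)))) (hs : s.Nonempty)
    (Q : Set (EuclideanSpace ℝ (Fin (k + 1))))
    (hQ : Q = convexHull ℝ (s : Set (EuclideanSpace ℝ (Fin (k + 1)))))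
    (NP : EuclideanSpace ℝ (Fin (k + 1)) → EuclideanSpace ℝ (Fin (k + 1)))
    (hNP : ∀ r, NP r ∈ Q ∧ ∀ v ∈ Q, ‖NP r - r‖ ≤ ‖v - r‖)
    (NF : EuclideanSpace ℝ (Fin (k + 1)) → Set (EuclideanSpace ℝ (Fin (k + 1))))
    (hNF : ∀ r, NF r = {v ∈ Q | ⟪r - NP r, v⟫ = ⟪r - NP r, NP r⟫})
    (ax : ℝ → EuclideanSpace ℝ (Fin (k + 1)))
    (hax : ∀ ρ, (∀ i : Fin k, ax ρ i.castSucc = 0) ∧ ax ρ (Fin.last k) = ρ)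
    (vLP : EuclideanSpace ℝ (Fin (k + 1)))
    (hvLPQ : vLP ∈ Q) (hvLPax : ∀ i : Fin k, vLP i.castSucc = 0)
    (hvLPmin : ∀ v ∈ Q, (∀ i : Fin k, v i.castSucc = 0) →
      vLP (Fin.last k) ≤ v (Fin.last k))
    (ρ₁ ρ₂ : ℝ) (h₁₂ : ρ₁ < ρ₂) (h₂ : ρ₂ < vLP (Fin.last k))
    (hsame : NF (ax ρ₁) = NF (ax ρ₂)) :
    ∀ ρ ∈ Set.Icc ρ₁ ρ₂, NF (ax ρ) = NF (ax ρ₁) := by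
  have hconv : Convex ℝ Q := hQ ▸ convex_convexHull ℝ _
  have hvar : ∀ r, ∀ v ∈ Q, ⟪r - NP r, v⟫ ≤ ⟪r - NP r, NP r⟫ := by
    intro r v hv
    have hne : Nonempty Q := ⟨⟨NP r, (hNP r).1⟩⟩
    have h := (norm_eq_iInf_iff_real_inner_le_zero hconv (u := r) (hNP r).1).1 (by
      apply le_antisymm
      · apply le_ciInf
        intro w
        rw [norm_sub_rev, norm_sub_rev r]
        exact (hNP r).2 w w.2
      · exact ciInf_le (f := fun w : Q => ‖r - (w : EuclideanSpace ℝ (Fin (k + 1)))‖)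
          ⟨0, by rintro _ ⟨w, rfl⟩; exact norm_nonneg _⟩ ⟨NP r, (hNP r).1⟩) v hv
    rw [inner_sub_right] at h
    linarith
  have huniq : ∀ r, ∀ p ∈ Q, (∀ v ∈ Q, ⟪r - p, v⟫ ≤ ⟪r - p, p⟫) → NP r = p := by
    intro r p hp h
    have h1 := hvar r p hp
    have h2 := h (NP r) (hNP r).1
    have h3 : ⟪NP r - p, NP r - p⟫ ≤ 0 := by
      simp only [inner_sub_left, inner_sub_right] at h1 h2 ⊢
      linarith
    have h4 := inner_self_eq_zero.1 (le_antisymm h3 real_inner_self_nonneg)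
    exact sub_eq_zero.1 h4
  intro ρ hρ
  have hd : 0 < ρ₂ - ρ₁ := sub_pos.2 h₁₂
  obtain ⟨c, t, hc, ht, hct, hρe⟩ : ∃ c t : ℝ, 0 ≤ c ∧ 0 ≤ t ∧ c + t = 1 ∧
      ρ = c * ρ₁ + t * ρ₂ := by
    refine ⟨(ρ₂ - ρ) / (ρ₂ - ρ₁), (ρ - ρ₁) / (ρ₂ - ρ₁), div_nonneg (sub_nonneg.2 hρ.2) hd.le,
      div_nonneg (sub_nonneg.2 hρ.1) hd.le, ?_, ?_⟩
    · field_simp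
      ring
    · field_simp
      ring
  have hr : ax ρ = c • ax ρ₁ + t • ax ρ₂ := by
    ext i
    refine Fin.lastCases ?_ (fun j => ?_) i
    · simp [(hax _).2, hρe]
    · simp [(hax _).1]
  have m1 : NP (ax ρ₁) ∈ NF (ax ρ₂) := by
    rw [← hsame, hNF]
    exact ⟨(hNP _).1, rfl⟩
  have m2 : NP (ax ρ₂) ∈ NF (ax ρ₁) := by
    rw [hsame, hNF]
    exact ⟨(hNP _).1, rfl⟩
  rw [hNF] at m1 m2
  have e1 := m1.2
  have e2 := m2.2
  have v1 := hvar (ax ρ₁)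
  have v2 := hvar (ax ρ₂)
  have q1 := (hNP (ax ρ₁)).1
  have q2 := (hNP (ax ρ₂)).1
  have key : ∀ v, v ∈ Q → (⟪ax ρ₁ - NP (ax ρ₁), v⟫ = ⟪ax ρ₁ - NP (ax ρ₁), NP (ax ρ₁)⟫ ↔
      ⟪ax ρ₂ - NP (ax ρ₂), v⟫ = ⟪ax ρ₂ - NP (ax ρ₂), NP (ax ρ₂)⟫) := by
    intro v hv
    have h := Set.ext_iff.1 hsame v
    rw [hNF, hNF] at h
    simpa [hv] using h
  rw [hNF, hNF]
  generalize ax ρ₁ = r1 at *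
  generalize ax ρ₂ = r2 at *
  generalize NP r1 = p1 at *
  generalize NP r2 = p2 at *
  have hexp : ∀ v, ⟪ax ρ - (c • p1 + t • p2), v⟫ = c * ⟪r1 - p1, v⟫ + t * ⟪r2 - p2, v⟫ := by
    intro v
    rw [hr]
    simp only [inner_sub_left, inner_add_left, real_inner_smul_left]
    ring
  have hb : ⟪ax ρ - (c • p1 + t • p2), c • p1 + t • p2⟫
      = c * ⟪r1 - p1, p1⟫ + t * ⟪r2 - p2, p2⟫ := by
    rw [hexp, inner_add_right, inner_add_right, real_inner_smul_right, real_inner_smul_right,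
      real_inner_smul_right, real_inner_smul_right, e1, e2]
    linear_combination (c * ⟪r1 - p1, p1⟫ + t * ⟪r2 - p2, p2⟫) * hct
  have hp : NP (ax ρ) = c • p1 + t • p2 := by
    apply huniq _ _ (hconv q1 q2 hc ht hct)
    intro v hv
    rw [hb, hexp]
    exact add_le_add (mul_le_mul_of_nonneg_left (v1 v hv) hc)
      (mul_le_mul_of_nonneg_left (v2 v hv) ht)
  rw [hp]
  ext v
  simp only [Set.mem_ofPred_eq]
  refine and_congr_right fun hv => ?_
  rw [hb, hexp]
  have i1 := mul_le_mul_of_nonneg_left (v1 v hv) hc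
  have i2 := mul_le_mul_of_nonneg_left (v2 v hv) ht
  constructor
  · intro h
    rcases hc.eq_or_lt with h0 | h0
    · have ht1 : t ≠ 0 := by
        intro h'
        linarith
      exact (key v hv).2 (mul_left_cancel₀ ht1 (by linarith))
    · exact mul_left_cancel₀ h0.ne' (by linarith)
  · intro h
    rw [h, (key v hv).1 h]
end

section
/- Sufficiently close reference points below the lowest piercing point induce a nearest face containing that piercing point. Precisely: there exists ε > 0 such that for every t with 0 < t < ε, the reference point r = v_LP − t·e_{k+1} (i.e. the point of A_c with last coordinate z_LP − t) satisfies v_LP ∈ NF(r). -/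
open RealInnerProductSpace

/-- Sufficiently close reference points below the lowest piercing point induce a nearest
face containing that piercing point: there is `ε > 0` such that for all `0 < t < ε`, the
reference point `r = v_LP - t·e_{k+1}` satisfies `v_LP ∈ NF(r)`. -/
theorem close_reference_points_capture_optimum {k : ℕ}
    (s : Finset (EuclideanSpace ℝ (Fin (k + 1)))) (hs : s.Nonempty)
    (Q : Set (EuclideanSpace ℝ (Fin (k + 1))))
    (hQ : Q = convexHull ℝ (s : Set (EuclideanSpace ℝ (Fin (k + 1)))))
    (NP : EuclideanSpace ℝ (Fin (k + 1)) → EuclideanSpace ℝ (Fin (k + 1)))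
    (hNP : ∀ r, NP r ∈ Q ∧ ∀ v ∈ Q, ‖NP r - r‖ ≤ ‖v - r‖)
    (NF : EuclideanSpace ℝ (Fin (k + 1)) → Set (EuclideanSpace ℝ (Fin (k + 1))))
    (hNF : ∀ r, NF r = {v ∈ Q | ⟪r - NP r, v⟫ = ⟪r - NP r, NP r⟫})
    (vLP : EuclideanSpace ℝ (Fin (k + 1)))
    (hvLPQ : vLP ∈ Q) (hvLPax : ∀ i : Fin k, vLP i.castSucc = 0)
    (hvLPmin : ∀ v ∈ Q, (∀ i : Fin k, v i.castSucc = 0) →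
      vLP (Fin.last k) ≤ v (Fin.last k)) :
    ∃ ε > 0, ∀ t : ℝ, 0 < t → t < ε →
      vLP ∈ NF (vLP - t • EuclideanSpace.single (Fin.last k) (1 : ℝ)) := by
  subst hQ
  have hev : ∀ᶠ p in nhds vLP, ∀ S ∈ s.powerset,
      p ∈ convexHull ℝ (S : Set (EuclideanSpace ℝ (Fin (k + 1)))) →
      vLP ∈ convexHull ℝ (S : Set (EuclideanSpace ℝ (Fin (k + 1)))) := by
    rw [Filter.eventually_all_finset]
    intro S _
    by_cases h : vLP ∈ convexHull ℝ (S : Set (EuclideanSpace ℝ (Fin (k + 1))))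
    · exact Filter.Eventually.of_forall fun _ _ => h
    · have hc : IsClosed (convexHull ℝ (S : Set (EuclideanSpace ℝ (Fin (k + 1))))) :=
        S.finite_toSet.isClosed_convexHull ℝ
      filter_upwards [hc.isOpen_compl.mem_nhds h] with p hp hp'
      exact absurd hp' hp
  obtain ⟨δ, hδ, hball⟩ := Metric.eventually_nhds_iff.1 hev
  refine ⟨δ / 2, by positivity, fun t ht0 ht => ?_⟩
  set r := vLP - t • EuclideanSpace.single (Fin.last k) (1 : ℝ) with hr
  obtain ⟨hpQ, hpmin⟩ := hNP r
  rw [hNF]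
  refine ⟨hvLPQ, ?_⟩
  set p := NP r with hp
  have hvr : ‖vLP - r‖ = t := by
    simp [hr, norm_smul, abs_of_pos ht0]
  have hdist : dist p vLP < δ := by
    have h1 := hpmin vLP hvLPQ
    have h2 : dist p vLP ≤ ‖p - r‖ + ‖vLP - r‖ := by
      rw [dist_eq_norm, show p - vLP = (p - r) - (vLP - r) by abel]
      exact norm_sub_le _ _
    linarith
  -- the variational inequality
  have hvar : ∀ w ∈ convexHull ℝ (s : Set (EuclideanSpace ℝ (Fin (k + 1)))),
      ⟪r - p, w - p⟫ ≤ 0 := by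
    refine (norm_eq_iInf_iff_real_inner_le_zero (convex_convexHull ℝ _) hpQ).1 ?_
    haveI : Nonempty (convexHull ℝ (s : Set (EuclideanSpace ℝ (Fin (k + 1))))) := ⟨⟨p, hpQ⟩⟩
    refine le_antisymm (le_ciInf fun w => ?_) ?_
    · rw [norm_sub_rev r p, norm_sub_rev r]
      exact hpmin w w.2
    · exact ciInf_le (f := fun w : convexHull ℝ (s : Set (EuclideanSpace ℝ (Fin (k + 1)))) =>
        ‖r - w‖) ⟨0, by rintro _ ⟨w, rfl⟩; exact norm_nonneg _⟩ ⟨p, hpQ⟩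
  obtain ⟨c, hc0, hc1, hcp⟩ := Finset.mem_convexHull'.1 hpQ
  -- weights vanish off the supporting hyperplane
  have hterm : ∀ w ∈ s, c w * ⟪r - p, w - p⟫ = 0 := by
    have hle : ∀ w ∈ s, c w * ⟪r - p, w - p⟫ ≤ 0 := fun w hw =>
      mul_nonpos_of_nonneg_of_nonpos (hc0 w hw) (hvar w (subset_convexHull ℝ _ hw))
    refine (Finset.sum_eq_zero_iff_of_nonpos hle).1 ?_
    have : ∑ w ∈ s, c w * ⟪r - p, w - p⟫ = ⟪r - p, ∑ w ∈ s, c w • (w - p)⟫ := by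
      simp only [inner_sum, inner_smul_right]
    rw [this]
    simp only [smul_sub, Finset.sum_sub_distrib, ← Finset.sum_smul, hc1, hcp]
    simp
  classical
  let S := s.filter fun w => c w ≠ 0
  have hpS : p ∈ convexHull ℝ (S : Set (EuclideanSpace ℝ (Fin (k + 1)))) := by
    refine Finset.mem_convexHull'.2 ⟨c, fun w hw => hc0 w (Finset.mem_filter.1 hw).1, ?_, ?_⟩
    · rw [Finset.sum_filter_ne_zero, hc1]
    · rw [← hcp]
      refine Finset.sum_subset (Finset.filter_subset _ _) fun w hw hw' => ?_
      have : c w = 0 := by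
        by_contra h
        exact hw' (Finset.mem_filter.2 ⟨hw, h⟩)
      simp [this]
  have hvS := hball hdist S (Finset.mem_powerset.2 (Finset.filter_subset _ _)) hpS
  obtain ⟨b, hb0, hb1, hbv⟩ := Finset.mem_convexHull'.1 hvS
  have hS : ∀ w ∈ S, ⟪r - p, w⟫ = ⟪r - p, p⟫ := fun w hw => by
    have hw' := Finset.mem_filter.1 hw
    have := (mul_eq_zero.1 (hterm w hw'.1)).resolve_left hw'.2
    rw [inner_sub_right] at this
    linarith
  rw [← hbv, inner_sum]
  simp only [inner_smul_right]
  rw [Finset.sum_congr rfl fun w hw => by rw [hS w hw], ← Finset.sum_mul, hb1, one_mul]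
end

section
/- Sliding a reference point along the segment towards the lowest piercing point preserves the induced face. Precisely: let r* = ρ·e_{k+1} with ρ < z_LP, let v_N = NP(r*), and assume v_LP ∈ NF(r*). Then for every λ ∈ (0, 1], setting r̄ = λ r* + (1−λ) v_LP and v̄ = λ v_N + (1−λ) v_LP, the inequality ⟪r̄ − v̄, v⟫ ≤ ⟪r̄ − v̄, v̄⟫ holds for all v ∈ Q, and {v ∈ Q : ⟪r̄ − v̄, v⟫ = ⟪r̄ − v̄, v̄⟫} = NF(r*). -/
open RealInnerProductSpace

/-- Sliding a reference point `r* = ρ·e_{k+1}` (with `ρ < z_LP` and `v_LP ∈ NF(r*)`) along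
the segment towards the lowest piercing point `v_LP` preserves the induced face: for every
`λ ∈ (0,1]`, with `r̄ = λ r* + (1-λ) v_LP` and `v̄ = λ NP(r*) + (1-λ) v_LP`, the inequality
`⟪r̄ - v̄, v⟫ ≤ ⟪r̄ - v̄, v̄⟫` is valid for `Q` and induces the face `NF(r*)`. -/
theorem sliding_reference_point_preserves_face {k : ℕ}
    (s : Finset (EuclideanSpace ℝ (Fin (k + 1)))) (hs : s.Nonempty)
    (Q : Set (EuclideanSpace ℝ (Fin (k + 1))))
    (hQ : Q = convexHull ℝ (s : Set (EuclideanSpace ℝ (Fin (k + 1)))))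
    (NP : EuclideanSpace ℝ (Fin (k + 1)) → EuclideanSpace ℝ (Fin (k + 1)))
    (hNP : ∀ r, NP r ∈ Q ∧ ∀ v ∈ Q, ‖NP r - r‖ ≤ ‖v - r‖)
    (NF : EuclideanSpace ℝ (Fin (k + 1)) → Set (EuclideanSpace ℝ (Fin (k + 1))))
    (hNF : ∀ r, NF r = {v ∈ Q | ⟪r - NP r, v⟫ = ⟪r - NP r, NP r⟫})
    (vLP : EuclideanSpace ℝ (Fin (k + 1)))
    (hvLPQ : vLP ∈ Q) (hvLPax : ∀ i : Fin k, vLP i.castSucc = 0)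
    (hvLPmin : ∀ v ∈ Q, (∀ i : Fin k, v i.castSucc = 0) →
      vLP (Fin.last k) ≤ v (Fin.last k))
    (ρ : ℝ) (hρ : ρ < vLP (Fin.last k))
    (rstar : EuclideanSpace ℝ (Fin (k + 1)))
    (hrax : ∀ i : Fin k, rstar i.castSucc = 0) (hrlast : rstar (Fin.last k) = ρ)
    (hvLPNF : vLP ∈ NF rstar)
    (lam : ℝ) (hlam : lam ∈ Set.Ioc (0 : ℝ) 1) :
    (∀ v ∈ Q,
      ⟪(lam • rstar + (1 - lam) • vLP) - (lam • NP rstar + (1 - lam) • vLP), v⟫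
        ≤ ⟪(lam • rstar + (1 - lam) • vLP) - (lam • NP rstar + (1 - lam) • vLP),
            lam • NP rstar + (1 - lam) • vLP⟫) ∧
    {v ∈ Q |
      ⟪(lam • rstar + (1 - lam) • vLP) - (lam • NP rstar + (1 - lam) • vLP), v⟫
        = ⟪(lam • rstar + (1 - lam) • vLP) - (lam • NP rstar + (1 - lam) • vLP),
            lam • NP rstar + (1 - lam) • vLP⟫} = NF rstar := by
  have hconv : Convex ℝ Q := hQ ▸ convex_convexHull ℝ _
  obtain ⟨hmem, hmin⟩ := hNP rstar
  have hvar : ∀ w ∈ Q, ⟪rstar - NP rstar, w - NP rstar⟫ ≤ 0 := by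
    refine (norm_eq_iInf_iff_real_inner_le_zero hconv hmem).1 ?_
    haveI : Nonempty Q := ⟨⟨_, hmem⟩⟩
    apply le_antisymm
    · refine le_ciInf fun w => ?_
      rw [norm_sub_rev, norm_sub_rev rstar]
      exact hmin w w.2
    · exact ciInf_le (f := fun w : Q => ‖rstar - (w : EuclideanSpace ℝ (Fin (k + 1)))‖)
        ⟨0, by rintro _ ⟨w, rfl⟩; exact norm_nonneg _⟩ ⟨NP rstar, hmem⟩
  have hd : (lam • rstar + (1 - lam) • vLP) - (lam • NP rstar + (1 - lam) • vLP)
      = lam • (rstar - NP rstar) := by module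
  rw [hNF] at hvLPNF ⊢
  have hLP := hvLPNF.2
  have hr : ⟪rstar - NP rstar, lam • NP rstar + (1 - lam) • vLP⟫
      = ⟪rstar - NP rstar, NP rstar⟫ := by
    rw [inner_add_right, real_inner_smul_right, real_inner_smul_right, hLP]
    ring
  simp only [hd, real_inner_smul_left, hr]
  refine ⟨fun v hv => ?_, ?_⟩
  · have h := hvar v hv
    rw [inner_sub_right] at h
    exact mul_le_mul_of_nonneg_left (by linarith) hlam.1.le
  · ext v
    simp only [Set.mem_setOf_eq, mul_right_inj' hlam.1.ne']
end

section
/- The reference point update of the combinatorial turbo LP decoder strictly increases the axis coordinate and never exceeds the lowest piercing point. Precisely: let r = ρ·e_{k+1} with ρ < z_LP (so a(r)_{k+1} < 0), and let s_{k+1} = b(r)/a(r)_{k+1} be the last coordinate of the intersection of the hyperplane {v : ⟪a(r), v⟫ = b(r)} with A_c. Then ρ < s_{k+1} ≤ z_LP. -/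
open RealInnerProductSpace

/-- The reference point update of the combinatorial turbo LP decoder strictly increases the
axis coordinate and never exceeds the lowest piercing point: for `r = ρ·e_{k+1}` with
`ρ < z_LP`, the updated coordinate `s_{k+1} = b(r)/a(r)_{k+1}` satisfies
`ρ < s_{k+1} ≤ z_LP`. -/
theorem reference_point_update_bounds {k : ℕ}
    (s : Finset (EuclideanSpace ℝ (Fin (k + 1)))) (hs : s.Nonempty)
    (Q : Set (EuclideanSpace ℝ (Fin (k + 1))))
    (hQ : Q = convexHull ℝ (s : Set (EuclideanSpace ℝ (Fin (k + 1)))))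
    (NP : EuclideanSpace ℝ (Fin (k + 1)) → EuclideanSpace ℝ (Fin (k + 1)))
    (hNP : ∀ r, NP r ∈ Q ∧ ∀ v ∈ Q, ‖NP r - r‖ ≤ ‖v - r‖)
    (vLP : EuclideanSpace ℝ (Fin (k + 1)))
    (hvLPQ : vLP ∈ Q) (hvLPax : ∀ i : Fin k, vLP i.castSucc = 0)
    (hvLPmin : ∀ v ∈ Q, (∀ i : Fin k, v i.castSucc = 0) →
      vLP (Fin.last k) ≤ v (Fin.last k))
    (ρ : ℝ) (hρ : ρ < vLP (Fin.last k))
    (r : EuclideanSpace ℝ (Fin (k + 1)))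
    (hrax : ∀ i : Fin k, r i.castSucc = 0) (hrlast : r (Fin.last k) = ρ) :
    ρ < ⟪r - NP r, NP r⟫ / (r - NP r) (Fin.last k) ∧
    ⟪r - NP r, NP r⟫ / (r - NP r) (Fin.last k) ≤ vLP (Fin.last k) := by
  obtain ⟨hpQ, hpmin⟩ := hNP r
  have hconv : Convex ℝ Q := by rw [hQ]; exact convex_convexHull ℝ _
  generalize NP r = p at hpQ hpmin ⊢
  have hax : ∀ a w : EuclideanSpace ℝ (Fin (k + 1)), (∀ i : Fin k, w i.castSucc = 0) →
      ⟪a, w⟫ = a (Fin.last k) * w (Fin.last k) := by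
    intro a w hw
    rw [PiLp.inner_apply, Fin.sum_univ_castSucc]
    simp [hw, mul_comm]
  have hne : r - p ≠ 0 := by
    intro h
    have h1 : r = p := sub_eq_zero.mp h
    have h2 := hvLPmin r (h1 ▸ hpQ) hrax
    linarith
  have hvar : ⟪r - p, vLP - p⟫ ≤ 0 := by
    haveI : Nonempty Q := ⟨⟨p, hpQ⟩⟩
    have hinf : ‖r - p‖ = ⨅ w : Q, ‖r - w‖ := by
      apply le_antisymm
      · apply le_ciInf
        intro w
        have := hpmin w w.2
        rwa [norm_sub_rev, norm_sub_rev r]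
      · exact ciInf_le (f := fun w : Q => ‖r - w‖)
          ⟨0, by rintro _ ⟨w, rfl⟩; exact norm_nonneg _⟩ ⟨p, hpQ⟩
    exact (norm_eq_iInf_iff_real_inner_le_zero hconv hpQ).1 hinf vLP hvLPQ
  have hpos : 0 < ⟪r - p, r - p⟫ := real_inner_self_pos.2 hne
  have e1 := hax (r - p) vLP hvLPax
  have e2 := hax (r - p) r hrax
  rw [inner_sub_right, e1] at hvar
  rw [inner_sub_right, e2, hrlast] at hpos
  generalize ⟪r - p, p⟫ = b at *
  generalize (r - p) (Fin.last k) = a at *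
  have ha : a < 0 := by
    by_contra h
    have := mul_nonneg (not_lt.1 h) (sub_pos.2 hρ).le
    nlinarith
  constructor
  · rw [lt_div_iff_of_neg ha]; linarith
  · rw [div_le_iff_of_neg ha]; linarith
end

section
/- A polytope has only finitely many faces. Precisely: let s ⊆ ℝ^n be a nonempty finite set and P = convexHull ℝ s. Then the collection of sets {F ⊆ ℝ^n : ∃ a ∈ ℝ^n, ∃ b ∈ ℝ, (∀ x ∈ P, ⟪a, x⟫ ≤ b) ∧ F = {x ∈ P : ⟪a, x⟫ = b}} is finite. -/
open RealInnerProductSpace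

/-- A polytope has only finitely many faces: the collection of faces induced by valid
inequalities of the convex hull of a nonempty finite set is finite. -/
theorem polytope_finitely_many_faces {n : ℕ}
    (s : Finset (EuclideanSpace ℝ (Fin n))) (hs : s.Nonempty)
    (P : Set (EuclideanSpace ℝ (Fin n)))
    (hP : P = convexHull ℝ (s : Set (EuclideanSpace ℝ (Fin n)))) :
    {F : Set (EuclideanSpace ℝ (Fin n)) |
      ∃ (a : EuclideanSpace ℝ (Fin n)) (b : ℝ),
        (∀ x ∈ P, ⟪a, x⟫ ≤ b) ∧ F = {x ∈ P | ⟪a, x⟫ = b}}.Finite := by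
  classical
  subst hP
  refine ((s.powerset.finite_toSet).image
    (fun t : Finset (EuclideanSpace ℝ (Fin n)) => convexHull ℝ (t : Set _))).subset ?_
  rintro F ⟨a, b, hv, rfl⟩
  refine ⟨s.filter (fun y => ⟪a, y⟫ = b),
    Finset.mem_coe.2 (Finset.mem_powerset.2 (Finset.filter_subset _ _)), ?_⟩
  ext x
  constructor
  · intro hx
    refine ⟨convexHull_mono (Finset.coe_subset.2 (Finset.filter_subset _ _)) hx, ?_⟩
    obtain ⟨w, -, h1, rfl⟩ := Finset.mem_convexHull'.1 hx
    rw [inner_sum]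
    calc _ = ∑ y ∈ s.filter (fun y => ⟪a, y⟫ = b), w y * b := by
          refine Finset.sum_congr rfl fun y hy => ?_
          rw [real_inner_smul_right, (Finset.mem_filter.1 hy).2]
      _ = b := by rw [← Finset.sum_mul, h1, one_mul]
  · rintro ⟨hx, hb⟩
    obtain ⟨w, h0, h1, rfl⟩ := Finset.mem_convexHull'.1 hx
    have hsum : ∑ y ∈ s, w y * (b - ⟪a, y⟫) = 0 := by
      simp only [inner_sum, real_inner_smul_right] at hb
      simp only [mul_sub, Finset.sum_sub_distrib, ← Finset.sum_mul, h1, hb]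
      ring
    have hz := (Finset.sum_eq_zero_iff_of_nonneg (fun y hy =>
      mul_nonneg (h0 y hy) (sub_nonneg.2 (hv y (subset_convexHull ℝ _ hy))))).1 hsum
    have hw : ∀ y ∈ s, w y ≠ 0 → ⟪a, y⟫ = b := by
      intro y hy hne
      have := (mul_eq_zero.1 (hz y hy)).resolve_left hne
      linarith
    refine Finset.mem_convexHull'.2
      ⟨w, fun y hy => h0 y (Finset.mem_filter.1 hy).1, ?_, ?_⟩
    · rw [Finset.sum_filter_of_ne hw, h1]
    · refine Finset.sum_filter_of_ne fun y hy hne => hw y hy ?_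
      rintro h
      exact hne (by rw [h, zero_smul])
end

section
/- The line-search step of the nearest point algorithm admits a closed-form minimal step size. Precisely: let λ, μ ∈ ℝ^n with Σᵢ λᵢ = Σᵢ μᵢ = 1, λᵢ > 0 for all i, and μⱼ < 0 for at least one j. Then the set {θ ∈ [0,1] : ∀ i, θ λᵢ + (1−θ) μᵢ ≥ 0} has a minimum, and this minimum equals max{ μᵢ/(μᵢ − λᵢ) : μᵢ < 0 }, a value lying strictly between 0 and 1. -/
/-- The line-search step of the nearest point algorithm admits a closed-form minimal step
size: if `Σ λᵢ = Σ μᵢ = 1`, all `λᵢ > 0`, and some `μⱼ < 0`, then the set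
`{θ ∈ [0,1] : ∀ i, θ λᵢ + (1-θ) μᵢ ≥ 0}` has a minimum `θ₀`, `θ₀` is the maximum of
`{μᵢ/(μᵢ - λᵢ) : μᵢ < 0}`, and `θ₀` lies strictly between `0` and `1`. -/
theorem line_search_minimal_step {n : ℕ}
    (lam μ : Fin n → ℝ)
    (hlam_sum : ∑ i, lam i = 1) (hμ_sum : ∑ i, μ i = 1)
    (hlam_pos : ∀ i, 0 < lam i) (hμ_neg : ∃ j, μ j < 0) :
    ∃ θ₀ : ℝ,
      IsLeast {θ ∈ Set.Icc (0 : ℝ) 1 | ∀ i, 0 ≤ θ * lam i + (1 - θ) * μ i} θ₀ ∧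
      IsGreatest {x : ℝ | ∃ i, μ i < 0 ∧ x = μ i / (μ i - lam i)} θ₀ ∧
      θ₀ ∈ Set.Ioo (0 : ℝ) 1 := by
  classical
  have key : ∀ (i : Fin n) (θ : ℝ), μ i < 0 →
      (μ i / (μ i - lam i) ≤ θ ↔ 0 ≤ θ * lam i + (1 - θ) * μ i) := by
    intro i θ hi
    have hd : μ i - lam i < 0 := by linarith [hlam_pos i]
    rw [div_le_iff_of_neg hd]
    constructor <;> intro h <;> linarith
  obtain ⟨j, hj⟩ := hμ_neg
  obtain ⟨k, hk, hmax⟩ := Finset.exists_max_image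
    (Finset.univ.filter (fun i => μ i < 0)) (fun i => μ i / (μ i - lam i))
    ⟨j, by simpa using hj⟩
  have hk : μ k < 0 := by simpa using hk
  have hmax : ∀ i, μ i < 0 → μ i / (μ i - lam i) ≤ μ k / (μ k - lam k) :=
    fun i hi => hmax i (by simpa using hi)
  have hd : μ k - lam k < 0 := by linarith [hlam_pos k]
  have h0 : 0 < μ k / (μ k - lam k) := div_pos_of_neg_of_neg hk hd
  have h1 : μ k / (μ k - lam k) < 1 := by
    rw [div_lt_iff_of_neg hd]
    linarith [hlam_pos k]
  refine ⟨μ k / (μ k - lam k), ⟨⟨⟨h0.le, h1.le⟩, ?_⟩, ?_⟩, ⟨⟨k, hk, rfl⟩, ?_⟩, h0, h1⟩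
  · intro i
    by_cases hi : μ i < 0
    · exact (key i _ hi).1 (hmax i hi)
    · exact add_nonneg (mul_nonneg h0.le (hlam_pos i).le)
        (mul_nonneg (by linarith) (not_lt.1 hi))
  · rintro θ ⟨_, hθ⟩
    exact (key k θ hk).2 (hθ k)
  · rintro x ⟨i, hi, rfl⟩
    exact hmax i hi
end
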